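/- arXiv:0809.3704 — 4 statements merged into one kernel-verified Lean document; each statement's English description precedes it below -/
import Mathlib

section
/- Let S be a residually free group and let z be a nontrivial element of the centre Z(S). Then for every integer n ≥ 1, z^n does not lie in the commutator subgroup [S, S]; equivalently, the restriction to Z(S) of the natural map S → H_1(S, ℤ)/(torsion) is injective. -/
/-- A free group with a nontrivial central element has at most one generator. -/
theorem FreeGroup.subsingleton_of_mem_center {α : Type*} {z : FreeGroup α}
    (hz : z ∈ Subgroup.center (FreeGroup α)) (hz1 : z ≠ 1) : Subsingleton α := by
  classical
  by_contra hα
  rw [not_subsingleton_iff_nontrivial] at hα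
  obtain ⟨⟨x, b⟩, L, hL⟩ := List.exists_cons_of_ne_nil (mt FreeGroup.toWord_eq_nil_iff.mp hz1)
  obtain ⟨y, hy⟩ := exists_ne x
  have hword : (FreeGroup.of y * z).toWord = (y, true) :: z.toWord := by
    have hred : FreeGroup.IsReduced ((y, true) :: z.toWord) := by
      have := FreeGroup.isReduced_toWord (x := z)
      rw [hL] at this ⊢
      simp [FreeGroup.isReduced_cons_cons, this, hy]
    rw [FreeGroup.toWord_mul, FreeGroup.toWord_of]
    exact hred.reduce_eq
  have hsub := FreeGroup.toWord_mul_sublist z (FreeGroup.of y)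
  rw [← Subgroup.mem_center_iff.mp hz, hword, FreeGroup.toWord_of] at hsub
  have heq := hsub.eq_of_length (by simp)
  simp [hL, hy] at heq

/-- A free group on at most one generator is commutative. -/
theorem FreeGroup.mul_comm_of_subsingleton {α : Type*} [Subsingleton α]
    (g h : FreeGroup α) : g * h = h * g := by
  have hof (a : α) (k : FreeGroup α) : Commute (FreeGroup.of a) k := by
    induction k using FreeGroup.induction_on with
    | C1 => exact Commute.one_right _
    | of b => rw [Subsingleton.elim b a]
    | inv_of b hb => exact hb.inv_right
    | mul x y hx hy => exact hx.mul_right hy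
  change Commute g h
  induction g using FreeGroup.induction_on with
  | C1 => exact Commute.one_left _
  | of a => exact hof a h
  | inv_of a ha => exact ha.inv_left
  | mul x y hx hy => exact hx.mul_left hy


/-- A group is *residually free* if every nontrivial element has nontrivial image under
some homomorphism to a free group (equivalently, to the free group of rank 2). -/
def ResiduallyFree (G : Type*) [Group G] : Prop :=
  ∀ g : G, g ≠ 1 → ∃ φ : G →* FreeGroup (Fin 2), φ g ≠ 1

/-- **Lemma 6.2(1).** If `S` is residually free and `z` is a nontrivial central element,
then no positive power of `z` lies in the commutator subgroup `[S,S]`; equivalently, the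
restriction of `S → H₁(S,ℤ)/(torsion)` to the centre is injective. -/
theorem center_pow_not_mem_commutator {S : Type*} [Group S] (h : ResiduallyFree S)
    (z : S) (hz : z ∈ Subgroup.center S) (hz1 : z ≠ 1) :
    ∀ n : ℕ, 1 ≤ n → z ^ n ∉ commutator S := by
  intro n hn hmem
  obtain ⟨φ, hφ⟩ := h z hz1
  let e := IsFreeGroup.toFreeGroup φ.range
  let ψ : S →* FreeGroup (IsFreeGroup.Generators φ.range) :=
    e.toMonoidHom.comp φ.rangeRestrict
  have hψ : Function.Surjective ψ := e.surjective.comp φ.rangeRestrict_surjective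
  have hψz : ψ z ≠ 1 := fun h1 =>
    hφ (congrArg Subtype.val ((map_eq_one_iff e e.injective).mp h1))
  have hcenter : ψ z ∈ Subgroup.center (FreeGroup (IsFreeGroup.Generators φ.range)) := by
    rw [Subgroup.mem_center_iff] at hz ⊢
    intro g
    obtain ⟨s, rfl⟩ := hψ g
    rw [← map_mul, hz s, map_mul]
  have := FreeGroup.subsingleton_of_mem_center hcenter hψz
  let _ : CommGroup (FreeGroup (IsFreeGroup.Generators φ.range)) :=
    { mul_comm := FreeGroup.mul_comm_of_subsingleton }
  have hpow : ψ z ^ n = 1 := by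
    rw [← map_pow]
    exact Abelianization.commutator_subset_ker ψ hmem
  exact hψz ((pow_eq_one_iff_left (by lia)).mp hpow)
end

section
/- Let D = Γ_1 × ⋯ × Γ_n be a direct product of non-abelian limit groups, let S ≤ D be a full subdirect product, and set L_i = S ∩ Γ_i (the intersection with the i-th coordinate subgroup) and M_i = S ∩ ker(p_i). Then for every automorphism θ of S there exists a permutation σ of {1, …, n} with θ(M_i) = M_{σ(i)} for all i, and a permutation τ of {1, …, n} with θ(L_i) = L_{τ(i)} for all i; that is, the sets of subgroups {L_1, …, L_n} and {M_1, …, M_n} are characteristic in S. -/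
/-- A group is *fully residually free* if for every finite subset there is a homomorphism
to a free group (equivalently, to the free group of rank 2) injective on that subset. -/
def FullyResiduallyFree (G : Type*) [Group G] : Prop :=
  ∀ A : Finset G, ∃ φ : G →* FreeGroup (Fin 2), Set.InjOn φ ↑A

/-- A *limit group* is a finitely generated fully residually free group. -/
def IsLimitGroup (G : Type*) [Group G] : Prop :=
  Group.FG G ∧ FullyResiduallyFree G

namespace FreeGroup

variable {X : Type*}

/-- A free group with a nontrivial central element has at most one free generator. -/
theorem subsingleton_of_central {z : FreeGroup X} (hz : z ≠ 1) (hc : ∀ g, Commute z g) :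
    Subsingleton X := by
  classical
  by_contra hX
  have hne : z.toWord ≠ [] := by simpa using hz
  obtain ⟨y, hy⟩ : ∃ y, y ≠ (z.toWord.head hne).1 := by
    by_contra! h
    exact hX ⟨fun a b ↦ (h a).trans (h b).symm⟩
  obtain ⟨p, w, hw⟩ := List.exists_cons_of_ne_nil hne
  have hpy : y ≠ p.1 := by simpa [hw] using hy
  set c := (z.toWord.getLast hne).2 with hcdef
  have hred : IsReduced z.toWord := isReduced_toWord
  have h₁ : IsReduced ((y, c) :: z.toWord) := by
    rw [hw, isReduced_cons_cons, ← hw]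
    exact ⟨fun h ↦ absurd h hpy, hred⟩
  have h₂ : IsReduced (z.toWord ++ [(y, c)]) := by
    refine List.IsChain.append hred (List.isChain_singleton _) ?_
    intro a ha b hb _
    rw [List.getLast?_eq_getLast_of_ne_nil hne] at ha
    simp only [Option.mem_def, Option.some.injEq, List.head?_cons] at ha hb
    rw [← ha, ← hb]
  have h := congrArg toWord (hc (mk [(y, c)])).eq
  rw [← mk_toWord (x := z), mul_mk, mul_mk, toWord_mk, toWord_mk, h₂.reduce_eq,
    List.singleton_append, h₁.reduce_eq, hw] at h
  simp only [List.cons_append, List.cons.injEq] at h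
  exact hpy (by rw [h.1])

end FreeGroup

namespace IsFreeGroup

variable {G : Type*} [Group G] [IsFreeGroup G]

/-- A free group with nontrivial center is cyclic. -/
theorem isCyclic_of_central {z : G} (hz : z ≠ 1) (hc : ∀ g, Commute z g) : IsCyclic G := by
  have : Subsingleton (Generators G) := by
    refine FreeGroup.subsingleton_of_central (z := toFreeGroup G z) (by simpa using hz) fun g ↦ ?_
    simpa using (hc ((toFreeGroup G).symm g)).map (toFreeGroup G)
  suffices IsCyclic (FreeGroup (Generators G)) from
    isCyclic_of_surjective (toFreeGroup G).symm (toFreeGroup G).symm.surjective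
  rcases isEmpty_or_nonempty (Generators G) with h | ⟨⟨x⟩⟩
  · infer_instance
  · refine ⟨FreeGroup.of x, fun g ↦ ?_⟩
    have hg : g ∈ Subgroup.closure (Set.range (FreeGroup.of (α := Generators G))) := by
      rw [FreeGroup.closure_range_of]; trivial
    change g ∈ Subgroup.zpowers (FreeGroup.of x)
    rw [Subgroup.zpowers_eq_closure]
    refine Subgroup.closure_mono ?_ hg
    rintro _ ⟨y, rfl⟩
    rw [Subsingleton.elim y x]
    rfl

theorem commute_of_central {z : G} (hz : z ≠ 1) (hc : ∀ g, Commute z g) (a b : G) :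
    Commute a b := by
  have := isCyclic_of_central hz hc
  exact IsCyclic.isMulCommutative.is_comm.comm a b

/-- The centralizer of a nontrivial element of a free group is cyclic. -/
theorem isCyclic_centralizer {x : G} (hx : x ≠ 1) : IsCyclic (Subgroup.centralizer {x}) := by
  refine isCyclic_of_central (z := ⟨x, by simp [Subgroup.mem_centralizer_iff]⟩)
    (by simpa [Subtype.ext_iff] using hx) fun g ↦ Subtype.ext ?_
  exact Subgroup.mem_centralizer_iff.1 g.2 x rfl

/-- Free groups are commutative transitive. -/
theorem commute_trans {x a b : G} (hx : x ≠ 1) (ha : Commute a x) (hb : Commute x b) :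
    Commute a b := by
  have := isCyclic_centralizer hx
  have mem {c : G} (h : Commute x c) : c ∈ Subgroup.centralizer {x} := by
    rw [Subgroup.mem_centralizer_iff]
    rintro _ rfl
    exact h
  exact congrArg Subtype.val (IsCyclic.isMulCommutative.is_comm.comm
    (⟨a, mem ha.symm⟩ : Subgroup.centralizer {x}) ⟨b, mem hb⟩)

theorem isMulTorsionFree : IsMulTorsionFree G :=
  (toFreeGroup G).injective.isMulTorsionFree (toFreeGroup G).toMonoidHom

/-- If a nontrivial element of a free group commutes with all conjugates of a nontrivial element,
then the group is abelian. -/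
theorem commute_of_commute_conj {x a : G} (hx : x ≠ 1) (ha : a ≠ 1)
    (h : ∀ g, Commute x (g * a * g⁻¹)) (u v : G) : Commute u v := by
  have := isMulTorsionFree (G := G)
  have hax : Commute a x := by simpa using (h 1).symm
  have hconj (g : G) : Commute a (g * a * g⁻¹) := commute_trans hx hax (h g)
  have hgen := isCyclic_centralizer ha
  obtain ⟨⟨t, htA⟩, ht⟩ := hgen
  have hta : Commute a t := Subgroup.mem_centralizer_iff.1 htA a rfl
  have pow_of_commute {c : G} (hc : Commute a c) : ∃ k : ℤ, t ^ k = c := by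
    have hcA : c ∈ Subgroup.centralizer {a} := by
      rw [Subgroup.mem_centralizer_iff]
      rintro _ rfl
      exact hc
    obtain ⟨k, hk⟩ := ht ⟨c, hcA⟩
    exact ⟨k, congrArg Subtype.val hk⟩
  have ht1 : t ≠ 1 := by
    rintro rfl
    obtain ⟨k, hk⟩ := pow_of_commute (Commute.refl a)
    exact ha (by simpa using hk.symm)
  have hnorm (g : G) : ∃ k : ℤ, t ^ k = g * t * g⁻¹ := by
    refine pow_of_commute (commute_trans (x := g * a * g⁻¹) ?_ (hconj g) ?_)
    · simpa using ha
    · exact Commute.conj_iff g |>.2 hta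
  refine commute_of_central ht1 (fun g ↦ ?_) u v
  obtain ⟨k, hk⟩ := hnorm g
  obtain ⟨m, hm⟩ := hnorm g⁻¹
  have hkm : t ^ (k * m) = t ^ (1 : ℤ) := by
    have : (g⁻¹ * t * g⁻¹⁻¹) ^ k = g⁻¹ * t ^ k * g⁻¹⁻¹ := conj_zpow
    rw [mul_comm, zpow_mul, hm, this, hk]
    group
  have hkm1 : k * m = 1 :=
    injective_zpow_iff_not_isOfFinOrder.2 (not_isOfFinOrder_of_isMulTorsionFree ht1) hkm
  have hkk : k * k = 1 := by
    rcases Int.eq_one_or_neg_one_of_mul_eq_one hkm1 with rfl | rfl <;> rfl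
  have hg2 : Commute t (g ^ 2) := by
    have h₁ : (g * t * g⁻¹) ^ k = g * t ^ k * g⁻¹ := conj_zpow
    rw [← hk, ← zpow_mul, hkk, hk, zpow_one] at h₁
    calc
      t * g ^ 2 = g * (g * t * g⁻¹) * g⁻¹ * g ^ 2 := by rw [← h₁]
      _ = g ^ 2 * t := by simp [pow_two, mul_assoc]
  rcases eq_or_ne g 1 with rfl | hg
  · exact Commute.one_right t
  · exact commute_trans (x := g ^ 2) (by simpa using hg) hg2 ((Commute.refl g).pow_left 2)

end IsFreeGroup

/-- In a nonabelian fully residually free group, no nontrivial element commutes with all conjugates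
of a nontrivial element. -/
theorem FullyResiduallyFree.eq_one_or_eq_one {G : Type*} [Group G] (hG : FullyResiduallyFree G)
    (hna : ∃ u v : G, u * v ≠ v * u) {x a : G} (h : ∀ g, Commute x (g * a * g⁻¹)) :
    a = 1 ∨ x = 1 := by
  classical
  obtain ⟨u, v, huv⟩ := hna
  obtain ⟨φ, hφ⟩ := hG {1, x, a, u * v, v * u}
  by_contra! hne
  refine huv (hφ (by simp) (by simp) ?_)
  have hx : φ.rangeRestrict x ≠ 1 := fun hx ↦
    hne.2 (hφ (by simp) (by simp) ((congrArg Subtype.val hx).trans φ.map_one.symm))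
  have ha : φ.rangeRestrict a ≠ 1 := fun ha ↦
    hne.1 (hφ (by simp) (by simp) ((congrArg Subtype.val ha).trans φ.map_one.symm))
  have hc : Commute (φ.rangeRestrict u) (φ.rangeRestrict v) := by
    refine IsFreeGroup.commute_of_commute_conj hx ha (fun g ↦ ?_) _ _
    obtain ⟨g, rfl⟩ := φ.rangeRestrict_surjective g
    simpa using (h g).map φ.rangeRestrict
  simpa using congrArg Subtype.val hc.eq

/-- In a subdirect product of nonabelian fully residually free groups, an element commutes with all
conjugates of another one if and only if the two have disjoint supports. -/
theorem Subgroup.forall_commute_conj_iff {ι : Type*} {Γ : ι → Type*} [∀ i, Group (Γ i)]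
    (hfrf : ∀ i, FullyResiduallyFree (Γ i)) (hna : ∀ i, ∃ a b : Γ i, a * b ≠ b * a)
    {S : Subgroup (∀ i, Γ i)} (hsub : ∀ i, S.map (Pi.evalMonoidHom Γ i) = ⊤) (x s : S) :
    (∀ g : S, Commute x (g * s * g⁻¹)) ↔ ∀ j, s.1 j = 1 ∨ x.1 j = 1 := by
  constructor
  · intro h j
    refine (hfrf j).eq_one_or_eq_one (hna j) fun g ↦ ?_
    obtain ⟨y, hy, rfl⟩ : g ∈ S.map (Pi.evalMonoidHom Γ j) := by rw [hsub]; trivial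
    exact (h ⟨y, hy⟩).map ((Pi.evalMonoidHom Γ j).comp S.subtype)
  · intro h g
    refine Subtype.ext (funext fun j ↦ ?_)
    rcases h j with h | h <;> simp [h]

/-- **Proposition 6.3.** Let `S ≤ Γ₁ × ⋯ × Γ_n` be a full subdirect product of
non-abelian limit groups, `L_i = S ∩ Γ_i` and `M_i = S ∩ ker p_i` (viewed as subgroups of
`S`).  Every automorphism of `S` permutes the `M_i` and permutes the `L_i`; that is, the
sets `{L_1, …, L_n}` and `{M_1, …, M_n}` are characteristic in `S`. -/
theorem L_and_M_characteristic
    {n : ℕ} (Γ : Fin n → Type*) [∀ i, Group (Γ i)]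
    (hlim : ∀ i, IsLimitGroup (Γ i))
    (hna : ∀ i, ∃ a b : Γ i, a * b ≠ b * a)
    (S : Subgroup (∀ i, Γ i))
    (hsub : ∀ i, S.map (Pi.evalMonoidHom Γ i) = ⊤)
    (hfull : ∀ i, S ⊓ (MonoidHom.mulSingle Γ i).range ≠ ⊥)
    (θ : S ≃* S) :
    (∃ σ : Equiv.Perm (Fin n), ∀ i,
        ((Pi.evalMonoidHom Γ i).ker.subgroupOf S).map θ.toMonoidHom =
          (Pi.evalMonoidHom Γ (σ i)).ker.subgroupOf S) ∧
      (∃ τ : Equiv.Perm (Fin n), ∀ i,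
        ((MonoidHom.mulSingle Γ i).range.subgroupOf S).map θ.toMonoidHom =
          (MonoidHom.mulSingle Γ (τ i)).range.subgroupOf S) := by
  have hfrf i := (hlim i).2
  have key := Subgroup.forall_commute_conj_iff hfrf hna hsub
  have mem_range (i : Fin n) (y : ∀ i, Γ i) :
      y ∈ (MonoidHom.mulSingle Γ i).range ↔ ∀ j, j ≠ i → y j = 1 := by
    constructor
    · rintro ⟨g, rfl⟩ j hj
      exact Pi.mulSingle_eq_of_ne hj g
    · intro h
      refine ⟨y i, funext fun j ↦ ?_⟩
      rcases eq_or_ne j i with rfl | hj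
      · exact Pi.mulSingle_eq_same j (y j)
      · rw [h j hj]
        exact Pi.mulSingle_eq_of_ne hj (y i)
  have exists_mem (i : Fin n) : ∃ l : S, l.1 i ≠ 1 ∧ ∀ j, j ≠ i → l.1 j = 1 := by
    obtain ⟨y, hy⟩ := Subgroup.ne_bot_iff_exists_ne_one.1 (hfull i)
    have hy' := (mem_range i y.1).1 y.2.2
    refine ⟨⟨y.1, y.2.1⟩, fun hi ↦ hy (Subtype.ext (funext fun j ↦ ?_)), hy'⟩
    rcases eq_or_ne j i with rfl | hj
    · exact hi
    · exact hy' j hj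
  choose l hl hl' using exists_mem
  have orth (θ : S ≃* S) (x s : S) :
      (∀ j, (θ s).1 j = 1 ∨ (θ x).1 j = 1) ↔ ∀ j, s.1 j = 1 ∨ x.1 j = 1 := by
    rw [← key, ← key]
    refine ⟨fun h g ↦ ?_, fun h g ↦ ?_⟩
    · simpa using (h (θ g)).map θ.symm
    · simpa using (h (θ.symm g)).map θ
  have exists_le (θ : S ≃* S) (i : Fin n) : ∃ j, ∀ x : S, x.1 i = 1 → (θ x).1 j = 1 := by
    obtain ⟨j, hj⟩ : ∃ j, (θ (l i)).1 j ≠ 1 := by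
      by_contra! h
      have h1 : θ (l i) = 1 := Subtype.ext (funext h)
      rw [map_eq_one_iff θ θ.injective] at h1
      exact hl i (by rw [h1]; rfl)
    refine ⟨j, fun x hx ↦ ((orth θ x (l i)).2 (fun k ↦ ?_) j).resolve_left hj⟩
    rcases eq_or_ne k i with rfl | hk
    · exact Or.inr hx
    · exact Or.inl (hl' i k hk)
  have inj {i j : Fin n} (h : ∀ x : S, x.1 i = 1 → x.1 j = 1) : j = i := by
    by_contra hij
    exact hl j (h (l j) (hl' j i fun h ↦ hij h.symm))
  choose f hf using exists_le θ
  choose f' hf' using exists_le θ.symm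
  let σ : Equiv.Perm (Fin n) :=
    { toFun := f
      invFun := f'
      left_inv := fun i ↦ inj fun x hx ↦ by simpa using hf' _ _ (hf i x hx)
      right_inv := fun i ↦ inj fun x hx ↦ by simpa using hf _ _ (hf' i x hx) }
  have hσ (i : Fin n) (x : S) : (θ x).1 (σ i) = 1 ↔ x.1 i = 1 := by
    refine ⟨fun h ↦ ?_, hf i x⟩
    have h' := hf' _ _ h
    rw [θ.symm_apply_apply] at h'
    rwa [show f' (σ i) = i from σ.symm_apply_apply i] at h'
  refine ⟨⟨σ, fun i ↦ ?_⟩, ⟨σ, fun i ↦ ?_⟩⟩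
  · ext y
    obtain ⟨x, rfl⟩ := θ.surjective y
    rw [Subgroup.mem_map_equiv]
    simpa [Subgroup.mem_subgroupOf] using (hσ i x).symm
  · ext y
    obtain ⟨x, rfl⟩ := θ.surjective y
    rw [Subgroup.mem_map_equiv, θ.symm_apply_apply, Subgroup.mem_subgroupOf,
      Subgroup.mem_subgroupOf, mem_range, mem_range]
    refine ⟨fun h j hj ↦ ?_, fun h j hj ↦ ?_⟩
    · obtain ⟨k, rfl⟩ := σ.surjective j
      exact (hσ k x).2 (h k fun hk ↦ hj (by rw [hk]))
    · exact (hσ j x).1 (h (σ j) fun hk ↦ hj (σ.injective hk))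
end

section
/- Let D = Γ_1 × ⋯ × Γ_n be a direct product of non-abelian limit groups. Then every automorphism θ of D permutes the coordinate factor subgroups: there is a permutation σ of {1, …, n} such that θ maps the i-th coordinate copy of Γ_i onto the σ(i)-th coordinate copy of Γ_{σ(i)} for each i. In particular, the decomposition of D as a direct product of non-abelian limit groups is unique. -/
namespace FreeGroup

/-- A free group with two distinct generators has trivial center. -/
theorem eq_one_of_forall_commute {α : Type*} [Nontrivial α] {z : FreeGroup α}
    (hz : ∀ g, Commute z g) : z = 1 := by
  classical
  by_contra hne
  have hw : z.toWord ≠ [] := fun h => hne (toWord_eq_nil_iff.1 h)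
  obtain ⟨c, w, hcw⟩ := List.exists_cons_of_ne_nil hw
  obtain ⟨e, he⟩ := exists_ne c.1
  have hred : IsReduced ((e, true) :: z.toWord) := by
    have h := isReduced_toWord (x := z)
    rw [hcw] at h ⊢
    exact List.isChain_cons_cons.2 ⟨fun h' => absurd h' he, h⟩
  have hleft : (of e * z).toWord = (e, true) :: z.toWord := by
    rw [toWord_mul, toWord_of, List.singleton_append, hred.reduce_eq]
  have hsub := toWord_mul_sublist z (of e)
  rw [(hz (of e)).eq, hleft, toWord_of] at hsub
  have heq := hsub.eq_of_length (by simp)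
  rw [hcw, List.cons_append, List.cons.injEq] at heq
  exact he (congrArg Prod.fst heq.1)

end FreeGroup

/-- A free group with a nontrivial central element is commutative. -/
theorem IsFreeGroup.commute_of_central_ne_one {G : Type*} [Group G] [IsFreeGroup G] {z : G}
    (hz : ∀ g, Commute z g) (hne : z ≠ 1) (a b : G) : Commute a b := by
  let e := IsFreeGroup.toFreeGroup G
  rcases subsingleton_or_nontrivial (IsFreeGroup.Generators G) with hs | hn
  · have hcyc : IsCyclic (FreeGroup (IsFreeGroup.Generators G)) := by
      rcases isEmpty_or_nonempty (IsFreeGroup.Generators G) with he | ⟨⟨x⟩⟩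
      · infer_instance
      · let _ : Unique (IsFreeGroup.Generators G) := ⟨⟨x⟩, fun y => Subsingleton.elim y x⟩
        infer_instance
    apply e.injective
    rw [map_mul, map_mul]
    exact hcyc.isMulCommutative.is_comm.comm _ _
  · refine absurd (e.injective ?_) hne
    rw [map_one]
    refine FreeGroup.eq_one_of_forall_commute fun g => ?_
    simpa using (hz (e.symm g)).map e

/-- Commutation is transitive on the nontrivial elements of a free group. -/
theorem FreeGroup.commute_trans {α : Type*} {a z b : FreeGroup α} (hne : z ≠ 1)
    (ha : Commute z a) (hb : Commute z b) : Commute a b := by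
  let H := Subgroup.centralizer {z}
  have hmem {g : FreeGroup α} (hg : Commute z g) : g ∈ H :=
    Subgroup.mem_centralizer_singleton_iff.2 hg.symm.eq
  have hcomm : Commute (⟨a, hmem ha⟩ : H) ⟨b, hmem hb⟩ := by
    refine IsFreeGroup.commute_of_central_ne_one (z := ⟨z, hmem (Commute.refl z)⟩)
      (fun g => Subtype.ext ?_) (fun h => hne (congrArg Subtype.val h)) _ _
    exact (Subgroup.mem_centralizer_singleton_iff.1 g.2).symm
  exact congrArg Subtype.val hcomm

/-- Commutation is transitive on the nontrivial elements of a fully residually free group. -/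
theorem FullyResiduallyFree.commute_trans {G : Type*} [Group G] (hG : FullyResiduallyFree G)
    {a z b : G} (hne : z ≠ 1) (ha : Commute z a) (hb : Commute z b) : Commute a b := by
  classical
  obtain ⟨φ, hφ⟩ := hG {1, z, a * b, b * a}
  have hφz : φ z ≠ 1 := fun h => hne (hφ (by simp) (by simp) (h.trans (map_one φ).symm))
  refine hφ (by simp) (by simp) ?_
  rw [map_mul, map_mul]
  exact FreeGroup.commute_trans hφz (ha.map φ) (hb.map φ)

/-- If a product of groups surjects onto a nonabelian group in which commutation is transitive on
nontrivial elements, then the surjection kills all factors but exactly one. -/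
theorem exists_forall_ne_mulSingle_eq_one {ι : Type*} [Finite ι] [DecidableEq ι] {Γ : ι → Type*}
    [∀ i, Group (Γ i)] {G : Type*} [Group G]
    (hct : ∀ {a z b : G}, z ≠ 1 → Commute z a → Commute z b → Commute a b)
    (hna : ∃ a b : G, a * b ≠ b * a) (f : (∀ i, Γ i) →* G) (hf : Function.Surjective f) :
    ∃ i, ∀ k, k ≠ i → ∀ x : Γ k, f (Pi.mulSingle k x) = 1 := by
  by_cases h : ∃ i, ∃ x y : Γ i, ¬ Commute (f (Pi.mulSingle i x)) (f (Pi.mulSingle i y))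
  · obtain ⟨i, x, y, hxy⟩ := h
    refine ⟨i, fun k hk z => ?_⟩
    by_contra hz
    exact hxy (hct hz ((Pi.mulSingle_commute hk z x).map f) ((Pi.mulSingle_commute hk z y).map f))
  · push Not at h
    obtain ⟨a, b, hab⟩ := hna
    obtain ⟨a, rfl⟩ := hf a
    obtain ⟨b, rfl⟩ := hf b
    have hcomm : ∀ i j (x : Γ i) (y : Γ j),
        Commute (f (Pi.mulSingle i x)) (f (Pi.mulSingle j y)) := by
      intro i j x y
      by_cases hij : i = j
      · subst hij
        exact h i x y
      · exact (Pi.mulSingle_commute hij x y).map f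
    have hgen (c : G) (hc : ∀ i (x : Γ i), Commute c (f (Pi.mulSingle i x))) (g : ∀ i, Γ i) :
        Commute c (f g) := by
      have : (⊤ : Subgroup (∀ i, Γ i)) ≤ (Subgroup.centralizer {c}).comap f := by
        rw [← Subgroup.pi_top Set.univ, Subgroup.pi_le_iff]
        rintro i _ ⟨x, -, rfl⟩
        exact Subgroup.mem_centralizer_singleton_iff.2 (hc i x).symm.eq
      exact (Subgroup.mem_centralizer_singleton_iff.1 (this (Subgroup.mem_top g))).symm
    exact absurd (hgen _ (fun i x => (hgen _ (fun j y => hcomm i j x y) a).symm) b).eq hab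

/-- **Remark 6.4.** Every automorphism of a direct product `D = Γ₁ × ⋯ × Γ_n` of
non-abelian limit groups permutes the coordinate factor subgroups; in particular the
direct product decomposition of `D` into non-abelian limit groups is unique. -/
theorem automorphism_permutes_factors
    {n : ℕ} (Γ : Fin n → Type*) [∀ i, Group (Γ i)]
    (hlim : ∀ i, IsLimitGroup (Γ i))
    (hna : ∀ i, ∃ a b : Γ i, a * b ≠ b * a)
    (θ : (∀ i, Γ i) ≃* (∀ i, Γ i)) :
    ∃ σ : Equiv.Perm (Fin n), ∀ i,
      (MonoidHom.mulSingle Γ i).range.map θ.toMonoidHom =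
        (MonoidHom.mulSingle Γ (σ i)).range := by
  have key (j : Fin n) : ∃ i, ∀ k, k ≠ i → ∀ x : Γ k, θ (Pi.mulSingle k x) j = 1 :=
    exists_forall_ne_mulSingle_eq_one (hlim j).2.commute_trans (hna j)
      ((Pi.evalMonoidHom Γ j).comp θ.toMonoidHom)
      ((Function.surjective_eval j).comp θ.surjective)
  choose τ hτ using key
  have hnt (i : Fin n) : ∃ x : Γ i, x ≠ 1 := by
    obtain ⟨a, b, hab⟩ := hna i
    exact ⟨a, fun h => hab (by simp [h])⟩
  have hsurj : Function.Surjective τ := by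
    intro i
    by_contra! h
    obtain ⟨x, hx⟩ := hnt i
    have h1 : θ (Pi.mulSingle i x) = 1 := funext fun j => hτ j i (h j).symm x
    rw [EmbeddingLike.map_eq_one_iff, Pi.mulSingle_eq_one_iff] at h1
    exact hx h1
  let e := Equiv.ofBijective τ (Finite.injective_iff_bijective.1
    (Finite.injective_iff_surjective.2 hsurj))
  have hτe (i : Fin n) : τ (e.symm i) = i := e.apply_symm_apply i
  have hsupp (i : Fin n) (x : Γ i) :
      θ (Pi.mulSingle i x) = Pi.mulSingle (e.symm i) (θ (Pi.mulSingle i x) (e.symm i)) := by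
    funext j
    by_cases hj : j = e.symm i
    · subst hj
      simp
    · rw [Pi.mulSingle_eq_of_ne hj]
      exact hτ j i (fun h => hj (by rw [h]; exact (e.symm_apply_apply j).symm)) x
  refine ⟨e.symm, fun i => le_antisymm ?_ ?_⟩
  · rintro _ ⟨_, ⟨x, rfl⟩, rfl⟩
    exact ⟨_, (hsupp i x).symm⟩
  · rintro _ ⟨y, rfl⟩
    obtain ⟨g, hg⟩ := θ.surjective (Pi.mulSingle (e.symm i) y)
    refine ⟨Pi.mulSingle i (g i), ⟨g i, rfl⟩, ?_⟩
    change θ (Pi.mulSingle i (g i)) = Pi.mulSingle (e.symm i) y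
    have hcoord : θ (Pi.mulSingle i (g i)) (e.symm i) = θ g (e.symm i) := by
      have hker : (Subgroup.pi Set.univ fun k => if k = i then (⊥ : Subgroup (Γ k)) else ⊤) ≤
          ((Pi.evalMonoidHom Γ (e.symm i)).comp θ.toMonoidHom).ker := by
        rw [Subgroup.pi_le_iff]
        rintro k _ ⟨x, hx, rfl⟩
        by_cases hk : k = i
        · have hx1 : x = 1 := by simpa [hk] using hx
          rw [hx1, map_one]
          exact one_mem _
        · exact hτ (e.symm i) k (by rwa [hτe]) x
      have hmem : (Pi.mulSingle i (g i))⁻¹ * g ∈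
          Subgroup.pi Set.univ fun k => if k = i then (⊥ : Subgroup (Γ k)) else ⊤ := by
        intro k _
        by_cases hk : k = i
        · subst hk
          simp
        · simp [hk]
      have h1 : θ ((Pi.mulSingle i (g i))⁻¹ * g) (e.symm i) = 1 := hker hmem
      rw [map_mul, map_inv, Pi.mul_apply, Pi.inv_apply] at h1
      exact inv_mul_eq_one.1 h1
    rw [hsupp, hcoord, hg, Pi.mulSingle_eq_same]
end

section
/- Let G be a residually free group and let x, y ∈ G be elements that do not commute (xy ≠ yx). Then x and y freely generate a free subgroup of rank 2; that is, the homomorphism from the free group of rank 2 to G sending the two free generators to x and y respectively is injective. -/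
/-- Free groups are residually finite, witnessed by actions on finite sets. -/
theorem FreeGroup.exists_finite_perm_ne_one {α : Type*} (w : FreeGroup α) (hw : w ≠ 1) :
    ∃ (V : Set (FreeGroup α)) (_ : Finite V) (ρ : FreeGroup α →* Equiv.Perm V), ρ w ≠ 1 := by
  classical
  let V : Set (FreeGroup α) := {v | ∃ l : List (α × Bool), l <:+ w.toWord ∧ FreeGroup.mk l = v}
  have hV : V.Finite := by
    refine (w.toWord.tails.toFinset.image FreeGroup.mk).finite_toSet.subset ?_
    rintro v ⟨l, hl, rfl⟩
    simp only [Finset.coe_image, Set.mem_image]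
    exact ⟨l, by simpa using hl, rfl⟩
  have : Finite V := hV
  have : Fintype V := Fintype.ofFinite V
  have hext (a : α) : ∃ σ : Equiv.Perm V, ∀ (v : FreeGroup α) (h : v ∈ V)
      (h' : FreeGroup.of a * v ∈ V), σ ⟨v, h⟩ = ⟨FreeGroup.of a * v, h'⟩ := by
    let e : {v : V // FreeGroup.of a * v.1 ∈ V} ≃ {v : V // (FreeGroup.of a)⁻¹ * v.1 ∈ V} :=
      { toFun v := ⟨⟨FreeGroup.of a * v.1.1, v.2⟩, by simp⟩
        invFun v := ⟨⟨(FreeGroup.of a)⁻¹ * v.1.1, v.2⟩, by simp⟩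
        left_inv v := by simp
        right_inv v := by simp }
    exact ⟨e.extendSubtype, fun v h h' ↦ e.extendSubtype_apply_of_mem ⟨v, h⟩ h'⟩
  choose σ hσ using hext
  have hone : (1 : FreeGroup α) ∈ V := ⟨[], List.nil_suffix, rfl⟩
  have key (l : List (α × Bool)) (hl : l <:+ w.toWord) :
      FreeGroup.lift σ (FreeGroup.mk l) ⟨1, hone⟩ = (FreeGroup.mk l : FreeGroup α) := by
    induction l with
    | nil => simp [← FreeGroup.one_eq_mk]
    | cons p l ih =>
      obtain ⟨a, b⟩ := p
      have hl' : l <:+ w.toWord := (List.suffix_cons _ _).trans hl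
      have hsplit : FreeGroup.mk ((a, b) :: l) = FreeGroup.mk [(a, b)] * FreeGroup.mk l := rfl
      have hmem : FreeGroup.mk ((a, b) :: l) ∈ V := ⟨_, hl, rfl⟩
      have hmem' : FreeGroup.mk l ∈ V := ⟨_, hl', rfl⟩
      have ih' : FreeGroup.lift σ (FreeGroup.mk l) ⟨1, hone⟩ = ⟨FreeGroup.mk l, hmem'⟩ :=
        Subtype.ext (ih hl')
      rw [hsplit, _root_.map_mul, Equiv.Perm.mul_apply, ih']
      cases b with
      | true =>
        change (FreeGroup.lift σ (FreeGroup.of a) _).1 = _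
        rw [FreeGroup.lift_apply_of, hσ a _ hmem' hmem]
        rfl
      | false =>
        have hinv : FreeGroup.mk [(a, false)] = (FreeGroup.of a)⁻¹ := rfl
        have hcancel : FreeGroup.of a * FreeGroup.mk ((a, false) :: l) = FreeGroup.mk l := by
          rw [hsplit, hinv, mul_inv_cancel_left]
        have h := hσ a _ hmem (hcancel ▸ hmem')
        simp only [hcancel] at h
        rw [hinv, _root_.map_inv, FreeGroup.lift_apply_of, ← h,
          Equiv.Perm.inv_def, Equiv.symm_apply_apply]
        rfl
  refine ⟨V, hV, FreeGroup.lift σ, fun h ↦ hw ?_⟩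
  have := key w.toWord List.suffix_rfl
  simpa [FreeGroup.mk_toWord, h, eq_comm] using this

/-- A free group on at most one generator is commutative. -/
theorem FreeGroup.commute_of_subsingleton {X : Type*} [Subsingleton X] (u v : FreeGroup X) :
    Commute u v := by
  have h (v : FreeGroup X) (a : X) : Commute v (FreeGroup.of a) := by
    induction v using FreeGroup.induction_on with
    | C1 => exact Commute.one_left _
    | of b => rw [Subsingleton.elim b a]
    | inv_of b hb => exact hb.inv_left
    | mul x y hx hy => exact hx.mul_left hy
  induction v using FreeGroup.induction_on with
  | C1 => exact Commute.one_right _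
  | of b => exact h u b
  | inv_of b hb => exact hb.inv_right
  | mul x y hx hy => exact hx.mul_right hy

/-- A surjection between free groups that does not lower the number of generators, from a free
group of finite rank, is injective. -/
theorem FreeGroup.injective_of_surjective {α X : Type*} [Finite α] (j : α ↪ X)
    (ψ : FreeGroup α →* FreeGroup X) (hψ : Function.Surjective ψ) : Function.Injective ψ := by
  rw [injective_iff_map_eq_one]
  intro w hw
  by_contra hne
  obtain ⟨V, _, ρ, hρ⟩ := FreeGroup.exists_finite_perm_ne_one w hne
  let Q := Equiv.Perm V
  let pull : (X → Q) → (α → Q) := fun f ↦ FreeGroup.lift.symm ((FreeGroup.lift f).comp ψ)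
  have hres : Function.Injective pull := fun f g hfg ↦ by
    have h := FreeGroup.lift.symm.injective hfg
    rw [MonoidHom.cancel_right hψ] at h
    exact FreeGroup.lift.injective h
  let extend : (α → Q) → (X → Q) := fun f ↦ Function.extend j f (1 : X → Q)
  have hext : Function.Injective extend := Function.extend_injective j.injective _
  obtain ⟨f, hf⟩ := (Finite.surjective_of_injective (hres.comp hext)) (FreeGroup.lift.symm ρ)
  have h := FreeGroup.lift.symm.injective hf
  apply hρ
  rw [← h, MonoidHom.comp_apply, hw, _root_.map_one]

/-- Non-commuting elements of a free group freely generate a free subgroup. -/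
theorem FreeGroup.lift_injective_of_not_commute {α : Type*} (x y : FreeGroup α)
    (hxy : x * y ≠ y * x) :
    Function.Injective (FreeGroup.lift (![x, y] : Fin 2 → FreeGroup α)) := by
  set f := FreeGroup.lift (![x, y] : Fin 2 → FreeGroup α) with hf
  let e := IsFreeGroup.toFreeGroup f.range
  have hX : Nontrivial (IsFreeGroup.Generators f.range) := by
    by_contra h
    rw [not_nontrivial_iff_subsingleton] at h
    let xr : f.range := ⟨x, FreeGroup.of 0, by simp [hf]⟩
    let yr : f.range := ⟨y, FreeGroup.of 1, by simp [hf]⟩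
    have hc : xr * yr = yr * xr := e.injective (by
      simpa using (FreeGroup.commute_of_subsingleton (e xr) (e yr)).eq)
    exact hxy (congrArg Subtype.val hc)
  obtain ⟨a, b, hab⟩ := exists_pair_ne (IsFreeGroup.Generators f.range)
  have hj : Function.Injective ![a, b] := by
    intro i k
    fin_cases i <;> fin_cases k <;> simp [hab, hab.symm]
  have h := FreeGroup.injective_of_surjective ⟨_, hj⟩ (e.toMonoidHom.comp f.rangeRestrict)
    (e.surjective.comp f.rangeRestrict_surjective)
  intro u v huv
  exact h (congrArg e (Subtype.ext huv))

/-- In a residually free group, two non-commuting elements freely generate a free subgroup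
of rank 2: the induced homomorphism from the free group of rank 2 is injective. -/
theorem free_of_not_commute {G : Type*} [Group G] (h : ResiduallyFree G) (x y : G)
    (hxy : x * y ≠ y * x) :
    Function.Injective (FreeGroup.lift (![x, y] : Fin 2 → G)) := by
  obtain ⟨φ, hφ⟩ := h (x * y * (y * x)⁻¹) (by rwa [Ne, mul_inv_eq_one])
  rw [map_mul, map_inv, Ne, mul_inv_eq_one, map_mul, map_mul] at hφ
  have hcomp : FreeGroup.lift ![φ x, φ y] = φ.comp (FreeGroup.lift ![x, y]) := by
    ext i
    fin_cases i <;> simp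
  have hinj := FreeGroup.lift_injective_of_not_commute _ _ hφ
  rw [hcomp, MonoidHom.coe_comp] at hinj
  exact hinj.of_comp
end
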